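/- arXiv:1310.0425 — 2 statements merged into one kernel-verified Lean document; each statement's English description precedes it below -/
import Mathlib

section
/- There exist constants c₀, c₁ > 0 depending only on D such that the following holds. Let Γ₁ be a patch of radius r₁ over a D-plane Π₁ of a Hilbert space H, centered at z₁ and tangent to Π₁ at z₁, with ‖Γ₁‖_{Ċ^{1,1}} ≤ c₀/r₁. Let z₂ ∈ Γ₁ with ‖z₂ − z₁‖ < c₀·r₁, and let Π₂ be a D-plane with dist(Π₂, Π₁) < c₀. Then there exists a patch Γ₂ of radius c₁·r₁ over Π₂ centered at z₂ with ‖Γ₂‖_{Ċ^{1,1}} ≤ 200·c₀/r₁ and Γ₂ ∩ B_H(z₂, c₁·r₁/2) = Γ₁ ∩ B_H(z₂, c₁·r₁/2). -/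
open Metric

noncomputable section

variable {H : Type*} [NormedAddCommGroup H] [InnerProductSpace ℝ H]

/-- The domain of a patch of radius `r` over the plane `P`: the open ball of
radius `r` about the origin inside `P`. -/
def patchDom (P : Submodule ℝ H) (r : ℝ) : Set H := {x : H | x ∈ P ∧ ‖x‖ < r}

/-- `Γ` is a patch of radius `r` over the `D`-plane `P` centered at `z`,
represented by the map `Ψ : B_P(0,r) → P^⊥` (with `Ψ 0 = 0`) whose derivative
is `DΨ`; i.e. `Γ = z + {x + Ψ x : x ∈ B_P(0,r)}`. -/
def IsPatchRepr (P : Submodule ℝ H) (r : ℝ) (z : H) (Ψ : H → H) (DΨ : H → H →L[ℝ] H)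
    (Γ : Set H) : Prop :=
  (∀ x ∈ patchDom P r, Ψ x ∈ Pᗮ) ∧ Ψ 0 = 0 ∧
    (∀ x ∈ patchDom P r, HasFDerivWithinAt Ψ (DΨ x) (patchDom P r) x) ∧
    Γ = (fun x => z + x + Ψ x) '' patchDom P r


lemma inv_aux {E : Type*} [NormedAddCommGroup E] [NormedSpace ℝ E] [CompleteSpace E]
    {ρ : ℝ} (hρ : 0 < ρ) (g : E → E) (g' : E → E →L[ℝ] E) (g0 : g 0 = 0)
    (hg : ∀ v ∈ ball (0 : E) (2 * ρ), HasFDerivAt g (g' v) v)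
    (hb : ∀ v ∈ ball (0 : E) (2 * ρ), ‖g' v - ContinuousLinearMap.id ℝ E‖ ≤ 1 / 50) :
    Set.InjOn g (ball (0 : E) (2 * ρ)) ∧
    ∃ (h : E → E) (B : E → E →L[ℝ] E), ∀ y ∈ ball (0 : E) ρ,
      h y ∈ ball (0 : E) (2 * ρ) ∧ g (h y) = y ∧ HasFDerivAt h (B y) y ∧ ‖B y‖ ≤ 2 ∧
      (∀ x, B y (g' (h y) x) = x) ∧ (∀ x, g' (h y) (B y x) = x) ∧
      ∀ z ∈ ball (0 : E) ρ, ‖h y - h z‖ ≤ 2 * ‖y - z‖ := by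
  have key : ∀ x ∈ ball (0 : E) (2 * ρ), ∀ y ∈ ball (0 : E) (2 * ρ),
      ‖g x - g y - (x - y)‖ ≤ 1 / 50 * ‖x - y‖ := by
    intro x hx y hy
    have := Convex.norm_image_sub_le_of_norm_hasFDerivWithin_le'
      (fun v hv => (hg v hv).hasFDerivWithinAt) hb (convex_ball (0 : E) (2 * ρ)) hy hx
    simpa using this
  have lip : ∀ x ∈ ball (0 : E) (2 * ρ), ∀ y ∈ ball (0 : E) (2 * ρ),
      ‖x - y‖ ≤ 2 * ‖g x - g y‖ := by
    intro x hx y hy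
    have h1 := key x hx y hy
    have h2 : ‖x - y‖ ≤ ‖g x - g y‖ + ‖g x - g y - (x - y)‖ := by
      have := norm_sub_le (g x - g y) (g x - g y - (x - y))
      simpa using this
    have := norm_nonneg (x - y)
    linarith
  refine ⟨?_, ?_⟩
  · intro x hx y hy hxy
    have := lip x hx y hy
    rw [hxy, sub_self, norm_zero, mul_zero] at this
    exact sub_eq_zero.1 (norm_le_zero_iff.1 this)
  have ha : ApproximatesLinearOn g (ContinuousLinearMap.id ℝ E) (ball (0 : E) (2 * ρ))
      (1 / 50) := by
    intro x hx y hy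
    simpa using key x hx y hy
  let ri : (ContinuousLinearMap.id ℝ E).NonlinearRightInverse :=
    { toFun := id, nnnorm := 1, bound' := by simp, right_inv' := by simp }
  have hs := ha.surjOn_closedBall_of_nonlinearRightInverse ri (ε := 3 / 2 * ρ) (b := 0)
    (by positivity) (closedBall_subset_ball (by linarith))
  have hex : ∀ y : E, ∃ v : E, y ∈ ball (0 : E) ρ → v ∈ ball (0 : E) (2 * ρ) ∧ g v = y := by
    intro y
    by_cases hy : y ∈ ball (0 : E) ρ
    · have : y ∈ closedBall (g 0) (((ri.nnnorm : ℝ)⁻¹ - ((1 / 50 : NNReal) : ℝ)) * (3 / 2 * ρ)) := by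
        rw [g0]
        rw [mem_ball_zero_iff] at hy
        rw [mem_closedBall_zero_iff]
        have : (ri.nnnorm : ℝ) = 1 := rfl
        rw [this]
        push_cast
        linarith
      obtain ⟨v, hv, hv'⟩ := hs this
      exact ⟨v, fun _ => ⟨closedBall_subset_ball (by linarith) hv, hv'⟩⟩
    · exact ⟨0, fun h => absurd h hy⟩
  choose h hh using hex
  have hlip : ∀ y ∈ ball (0 : E) ρ, ∀ z ∈ ball (0 : E) ρ, ‖h y - h z‖ ≤ 2 * ‖y - z‖ := by
    intro y hy z hz
    have := lip _ (hh y hy).1 _ (hh z hz).1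
    rwa [(hh y hy).2, (hh z hz).2] at this
  have hB : ∀ y : E, ∃ e : E ≃L[ℝ] E, y ∈ ball (0 : E) ρ → (e : E →L[ℝ] E) = g' (h y) := by
    intro y
    by_cases hy : y ∈ ball (0 : E) ρ
    · have hlt : ‖ContinuousLinearMap.id ℝ E - g' (h y)‖ < 1 := by
        rw [norm_sub_rev]
        exact (hb _ (hh y hy).1).trans_lt (by norm_num)
      refine ⟨ContinuousLinearEquiv.ofUnit (Units.oneSub (ContinuousLinearMap.id ℝ E - g' (h y)) hlt), fun _ => ?_⟩
      ext x
      change ((1 : E →L[ℝ] E) - (ContinuousLinearMap.id ℝ E - g' (h y))) x = _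
      simp
    · exact ⟨ContinuousLinearEquiv.refl ℝ E, fun h => absurd h hy⟩
  choose e he using hB
  refine ⟨h, fun y => ((e y).symm : E →L[ℝ] E), fun y hy => ?_⟩
  have hey : ∀ x, g' (h y) x = e y x := fun x => by rw [← he y hy]; rfl
  refine ⟨(hh y hy).1, (hh y hy).2, ?_, ?_, ?_, ?_, hlip y hy⟩
  · have hd := hg _ (hh y hy).1
    rw [← he y hy] at hd
    refine HasFDerivAt.of_local_left_inverse ?_ hd ?_
    · have : LipschitzOnWith 2 h (ball (0 : E) ρ) :=
        lipschitzOnWith_iff_norm_sub_le.2 fun x hx z hz => hlip x hx z hz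
      exact this.continuousOn.continuousAt (isOpen_ball.mem_nhds hy)
    · filter_upwards [isOpen_ball.mem_nhds hy] with z hz using (hh z hz).2
  · refine ContinuousLinearMap.opNorm_le_bound _ (by norm_num) fun x => ?_
    have h1 := (g' (h y) - ContinuousLinearMap.id ℝ E).le_of_opNorm_le (hb _ (hh y hy).1)
      ((e y).symm x)
    have h2 : (g' (h y) - ContinuousLinearMap.id ℝ E) ((e y).symm x) = x - (e y).symm x := by
      simp [hey]
    rw [h2] at h1
    have h3 := norm_sub_le x (x - (e y).symm x)
    rw [sub_sub_cancel] at h3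
    have := norm_nonneg ((e y).symm x)
    change ‖(e y).symm x‖ ≤ _
    linarith
  · intro x; simp [hey]
  · intro x; simp [hey]

lemma patch_aux {H : Type*} [NormedAddCommGroup H] [InnerProductSpace ℝ H]
    (P : Submodule ℝ H) [CompleteSpace P] {ρ K : ℝ} (hρ : 0 < ρ) (hK : 0 ≤ K) (z : H)
    (φ : P → H) (φ' : P → P →L[ℝ] H) (φ0 : φ 0 = 0)
    (hφ : ∀ v ∈ ball (0 : P) (2 * ρ), HasFDerivAt φ (φ' v) v)
    (hb : ∀ v ∈ ball (0 : P) (2 * ρ), ‖φ' v - P.subtypeL‖ ≤ 1 / 50)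
    (hl : ∀ v ∈ ball (0 : P) (2 * ρ), ∀ w ∈ ball (0 : P) (2 * ρ), ‖φ' v - φ' w‖ ≤ K * ‖v - w‖) :
    ∃ (Γ : Set H) (Ψ : H → H) (DΨ : H → H →L[ℝ] H), IsPatchRepr P ρ z Ψ DΨ Γ ∧
      LipschitzOnWith (Real.toNNReal (200 * K)) DΨ (patchDom P ρ) ∧
      Γ ∩ ball z (ρ / 2) = ((fun v => z + φ v) '' ball (0 : P) (2 * ρ)) ∩ ball z (ρ / 2) := by
  set π := P.orthogonalProjectionOnto with hπ
  have πn : ∀ x, ‖π x‖ ≤ ‖x‖ := fun x => by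
    simpa using π.le_of_opNorm_le P.orthogonalProjectionOnto_norm_le x
  have πP : ∀ v : P, π (v : H) = v := fun v => by simp [hπ]
  obtain ⟨inj, h, B, hB⟩ := inv_aux hρ (fun v => π (φ v)) (fun v => π.comp (φ' v))
    (by simp [φ0]) (fun v hv => π.hasFDerivAt.comp v (hφ v hv)) (by
      intro v hv
      refine ContinuousLinearMap.opNorm_le_bound _ (by norm_num) fun x => ?_
      have h1 := (φ' v - P.subtypeL).le_of_opNorm_le (hb v hv) x
      refine le_trans ?_ h1
      refine le_trans (le_of_eq ?_) (πn _)
      congr 1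
      simp [πP])
  have φn : ∀ v ∈ ball (0 : P) (2 * ρ), ‖φ' v‖ ≤ 2 := by
    intro v hv
    have h1 : ‖P.subtypeL‖ ≤ 1 := P.norm_subtypeL_le
    have h2 := norm_add_le (φ' v - P.subtypeL) P.subtypeL
    rw [sub_add_cancel] at h2
    linarith [hb v hv]
  have dom : ∀ x ∈ patchDom P ρ, π x ∈ ball (0 : P) ρ ∧ (π x : H) = x := by
    rintro x ⟨hx, hx'⟩
    refine ⟨mem_ball_zero_iff.2 ((πn x).trans_lt hx'), ?_⟩
    have := πP ⟨x, hx⟩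
    exact congrArg Subtype.val this
  have h0 : h 0 = 0 := by
    have := hB 0 (mem_ball_self hρ)
    refine inj this.1 (mem_ball_self (by positivity)) ?_
    simp [this.2.1, φ0]
  refine ⟨_, fun x => φ (h (π x)) - (π x : H),
    fun x => ((φ' (h (π x))).comp (B (π x)) - P.subtypeL).comp π, ⟨?_, ?_, ?_, rfl⟩, ?_, ?_⟩
  · intro x hx
    have h1 := (hB _ (dom x hx).1).2.1
    rw [← Submodule.orthogonalProjectionOnto_eq_zero_iff]
    change π (φ (h (π x)) - (π x : H)) = 0
    rw [map_sub, πP, sub_eq_zero]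
    exact h1
  · simp [h0, φ0]
  · intro x hx
    obtain ⟨h1, h2, h3, -⟩ := hB _ (dom x hx).1
    have h4 : HasFDerivAt (fun y : P => φ (h y) - (y : H)) ((φ' (h (π x))).comp (B (π x)) - P.subtypeL) (π x) :=
      ((hφ _ h1).comp (π x) h3).sub P.subtypeL.hasFDerivAt
    exact (h4.comp x π.hasFDerivAt).hasFDerivWithinAt
  · refine lipschitzOnWith_iff_norm_sub_le.2 fun x hx y hy => ?_
    rw [Real.coe_toNNReal _ (by positivity)]
    obtain ⟨x1, x2, x3, x4, x5, x6, x7⟩ := hB _ (dom x hx).1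
    obtain ⟨y1, y2, y3, y4, y5, y6, y7⟩ := hB _ (dom y hy).1
    have hh : ‖h (π x) - h (π y)‖ ≤ 2 * ‖x - y‖ := by
      refine (x7 _ (dom y hy).1).trans ?_
      rw [← map_sub]
      have := πn (x - y)
      linarith
    have hd : ‖φ' (h (π x)) - φ' (h (π y))‖ ≤ 2 * K * ‖x - y‖ := by
      refine (hl _ x1 _ y1).trans ?_
      nlinarith
    set dd := 2 * K * ‖x - y‖ with hdd
    have dd0 : 0 ≤ dd := by positivity
    have hBB : ∀ w, ‖B (π x) w - B (π y) w‖ ≤ 4 * dd * ‖w‖ := by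
      intro w
      have e1 : B (π x) w - B (π y) w =
          B (π x) (π ((φ' (h (π y)) - φ' (h (π x))) (B (π y) w))) := by
        have a1 := y6 w
        have a2 := x5 (B (π y) w)
        simp only [ContinuousLinearMap.comp_apply] at a1 a2
        rw [sub_apply, map_sub, map_sub, a1, a2]
      rw [e1]
      have b1 := (B (π x)).le_of_opNorm_le x4 (π ((φ' (h (π y)) - φ' (h (π x))) (B (π y) w)))
      have b2 := πn ((φ' (h (π y)) - φ' (h (π x))) (B (π y) w))
      have b3 := (φ' (h (π y)) - φ' (h (π x))).le_of_opNorm_le ((norm_sub_rev _ _).trans_le hd) (B (π y) w)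
      have b4 := (B (π y)).le_of_opNorm_le y4 w
      have b5 := mul_le_mul_of_nonneg_left b4 dd0
      linarith
    refine ContinuousLinearMap.opNorm_le_bound _ (by positivity) fun u => ?_
    have e2 : (((φ' (h (π x))).comp (B (π x)) - P.subtypeL).comp π -
        ((φ' (h (π y))).comp (B (π y)) - P.subtypeL).comp π) u =
        (φ' (h (π x)) - φ' (h (π y))) (B (π x) (π u)) +
          φ' (h (π y)) (B (π x) (π u) - B (π y) (π u)) := by
      simp [map_sub]
    rw [e2]
    have c1 := (φ' (h (π x)) - φ' (h (π y))).le_of_opNorm_le hd (B (π x) (π u))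
    have c2 := (B (π x)).le_of_opNorm_le x4 (π u)
    have c3 := (φ' (h (π y))).le_of_opNorm_le (φn _ y1) (B (π x) (π u) - B (π y) (π u))
    have c4 := hBB (π u)
    have c5 := mul_le_mul_of_nonneg_left c2 dd0
    have c6 := mul_le_mul_of_nonneg_left (πn u) dd0
    have c7 : 0 ≤ dd * ‖u‖ := by positivity
    refine (norm_add_le _ _).trans ?_
    have : 200 * K * ‖x - y‖ * ‖u‖ = 100 * (dd * ‖u‖) := by rw [hdd]; ring
    rw [this]
    linarith
  · ext p
    refine and_congr_left fun hp => ⟨?_, ?_⟩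
    · rintro ⟨x, hx, rfl⟩
      refine ⟨h (π x), (hB _ (dom x hx).1).1, ?_⟩
      simp only [(dom x hx).2]
      abel
    · rintro ⟨v, hv, rfl⟩
      have hn : ‖φ v‖ < ρ / 2 := by simpa [mem_ball_iff_norm] using hp
      have hy : π (φ v) ∈ ball (0 : P) ρ :=
        mem_ball_zero_iff.2 ((πn _).trans_lt (by linarith))
      refine ⟨(π (φ v) : H), ⟨(π (φ v)).2, by simpa using mem_ball_zero_iff.1 hy⟩, ?_⟩
      have : h (π (φ v)) = v := inj (hB _ hy).1 hv (hB _ hy).2.1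
      simp only [πP, this]
      abel

/-- **Transferring a patch to a nearby center and a nearby plane.**
There are constants `c₀, c₁ > 0` depending only on `D` such that: if `Γ₁` is a
patch of radius `r₁` over a `D`-plane `P₁` centered at `z₁` and tangent to `P₁`
at `z₁` with `Ċ^{1,1}`-norm at most `c₀/r₁`, if `z₂ ∈ Γ₁` with `‖z₂ - z₁‖ < c₀ r₁`,
and if `P₂` is a `D`-plane with `dist(P₂, P₁) < c₀` (witnessed by an orthogonal
transformation `T` carrying `P₁` to `P₂` with `‖T - I‖ < c₀`), then there is a
patch `Γ₂` of radius `c₁ r₁` over `P₂` centered at `z₂`, of `Ċ^{1,1}`-norm at most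
`200 c₀ / r₁`, agreeing with `Γ₁` on the ball `B(z₂, c₁ r₁ / 2)`. -/
theorem patch_transfer (D : ℕ) (hD : 0 < D) :
    ∃ c₀ c₁ : ℝ, 0 < c₀ ∧ 0 < c₁ ∧
      ∀ (H : Type) [NormedAddCommGroup H] [InnerProductSpace ℝ H] [CompleteSpace H],
        (D : Cardinal) < Module.rank ℝ H →
      ∀ P₁ P₂ : Submodule ℝ H,
        Module.finrank ℝ P₁ = D → Module.finrank ℝ P₂ = D →
      ∀ r₁ : ℝ, 0 < r₁ →
      ∀ (z₁ z₂ : H) (Γ₁ : Set H) (Ψ₁ : H → H) (DΨ₁ : H → H →L[ℝ] H),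
        IsPatchRepr P₁ r₁ z₁ Ψ₁ DΨ₁ Γ₁ →
        DΨ₁ 0 = 0 →
        LipschitzOnWith (Real.toNNReal (c₀ / r₁)) DΨ₁ (patchDom P₁ r₁) →
        z₂ ∈ Γ₁ → ‖z₂ - z₁‖ < c₀ * r₁ →
        (∃ T : H ≃ₗᵢ[ℝ] H, Submodule.map (T.toLinearEquiv : H →ₗ[ℝ] H) P₁ = P₂ ∧
          ∃ c : ℝ, 0 ≤ c ∧ c < c₀ ∧ ∀ v : H, ‖T v - v‖ ≤ c * ‖v‖) →
        ∃ (Γ₂ : Set H) (Ψ₂ : H → H) (DΨ₂ : H → H →L[ℝ] H),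
          IsPatchRepr P₂ (c₁ * r₁) z₂ Ψ₂ DΨ₂ Γ₂ ∧
          LipschitzOnWith (Real.toNNReal (200 * c₀ / r₁)) DΨ₂ (patchDom P₂ (c₁ * r₁)) ∧
          Γ₂ ∩ Metric.ball z₂ (c₁ * r₁ / 2) = Γ₁ ∩ Metric.ball z₂ (c₁ * r₁ / 2) := by
  refine ⟨1 / 100, 1 / 4, by norm_num, by norm_num, ?_⟩
  intro H _ _ _ _ P₁ P₂ hP₁ hP₂ r₁ hr z₁ z₂ Γ₁ Ψ₁ DΨ₁ hΓ hD0 hLip hz₂ hz hT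
  obtain ⟨hΨo, hΨ0, hΨd, rfl⟩ := hΓ
  obtain ⟨T, hTP, c, hc0, hc, hTc⟩ := hT
  obtain ⟨a, ⟨haP, har⟩, haz⟩ := hz₂
  have : FiniteDimensional ℝ P₂ := Module.finite_of_finrank_pos (by omega)
  have hcr : (0 : ℝ) ≤ 1 / 100 / r₁ := by positivity
  have hL : ∀ x ∈ patchDom P₁ r₁, ∀ y ∈ patchDom P₁ r₁,
      ‖DΨ₁ x - DΨ₁ y‖ ≤ 1 / 100 / r₁ * ‖x - y‖ := by
    intro x hx y hy
    have := lipschitzOnWith_iff_norm_sub_le.1 hLip hx hy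
    rwa [Real.coe_toNNReal _ hcr] at this
  have h0d : (0 : H) ∈ patchDom P₁ r₁ := ⟨P₁.zero_mem, by simpa using hr⟩
  have hDn : ∀ x ∈ patchDom P₁ r₁, ‖DΨ₁ x‖ ≤ 1 / 100 := by
    intro x hx
    have h1 := hL x hx 0 h0d
    rw [hD0, sub_zero, sub_zero] at h1
    refine h1.trans ?_
    have h2 := mul_le_mul_of_nonneg_left hx.2.le hcr
    rwa [div_mul_cancel₀ _ hr.ne'] at h2
  have pyth : ∀ u ∈ P₁, ∀ w ∈ P₁ᗮ, ‖u‖ ≤ ‖u + w‖ := by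
    intro u hu w hw
    have h1 := norm_add_sq_eq_norm_sq_add_norm_sq_of_inner_eq_zero u w
      (Submodule.inner_right_of_mem_orthogonal hu hw)
    nlinarith [norm_nonneg u, norm_nonneg (u + w), norm_nonneg w]
  have ha : ‖a‖ < 1 / 100 * r₁ := by
    refine lt_of_le_of_lt ?_ hz
    have e : z₂ - z₁ = a + Ψ₁ a := by rw [← haz]; simp only []; abel
    rw [e]
    exact pyth a haP _ (hΨo a ⟨haP, har⟩)
  have hSP : ∀ v ∈ P₂, T.symm v ∈ P₁ := by
    intro v hv
    rw [← hTP] at hv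
    obtain ⟨u, hu, rfl⟩ := hv
    have : T.symm (T u) = u := T.symm_apply_apply u
    exact this.symm ▸ hu
  have hTP' : ∀ u ∈ P₁, T u ∈ P₂ := by
    intro u hu
    rw [← hTP]
    exact ⟨u, hu, rfl⟩
  have hSc : ∀ v : H, ‖T.symm v - v‖ ≤ 1 / 100 * ‖v‖ := by
    intro v
    have h1 := hTc (T.symm v)
    rw [T.apply_symm_apply, norm_sub_rev, LinearIsometryEquiv.norm_map] at h1
    exact h1.trans (by gcongr)
  let S : P₂ →L[ℝ] H := (T.symm.toContinuousLinearEquiv : H →L[ℝ] H).comp P₂.subtypeL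
  have hS : ∀ v : P₂, S v = T.symm v := fun v => rfl
  have hSn : ∀ v : P₂, ‖S v‖ = ‖v‖ := fun v => by rw [hS, LinearIsometryEquiv.norm_map]; rfl
  have hSd : ∀ v ∈ ball (0 : P₂) (2 * (1 / 4 * r₁)), a + S v ∈ patchDom P₁ r₁ := by
    intro v hv
    refine ⟨P₁.add_mem haP (hSP v v.2), ?_⟩
    have h1 := norm_add_le a (S v)
    rw [hSn] at h1
    rw [mem_ball_zero_iff] at hv
    linarith
  obtain ⟨Γ₂, Ψ₂, DΨ₂, h1, h2, h3⟩ := patch_aux P₂ (ρ := 1 / 4 * r₁) (K := 1 / 100 / r₁)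
    (by positivity) hcr z₂ (fun v => S v + (Ψ₁ (a + S v) - Ψ₁ a))
    (fun v => S + (DΨ₁ (a + S v)).comp S) (by simp) (by
      intro v hv
      have hi : HasFDerivWithinAt (fun v : P₂ => a + S v) S (ball (0 : P₂) (2 * (1 / 4 * r₁))) v :=
        (S.hasFDerivAt.const_add a).hasFDerivWithinAt
      have hc := ((hΨd _ (hSd v hv)).comp v hi hSd).hasFDerivAt (isOpen_ball.mem_nhds hv)
      exact S.hasFDerivAt.add (hc.sub_const _)) (by
      intro v hv
      refine ContinuousLinearMap.opNorm_le_bound _ (by norm_num) fun x => ?_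
      have e : (S + (DΨ₁ (a + S v)).comp S - P₂.subtypeL) x =
          (T.symm (x : H) - x) + DΨ₁ (a + S v) (S x) := by
        simp [hS]; abel
      rw [e]
      have b1 := hSc x
      have b2 := (DΨ₁ (a + S v)).le_of_opNorm_le (hDn _ (hSd v hv)) (S x)
      rw [hSn] at b2
      have b3 : ‖(x : H)‖ = ‖x‖ := rfl
      rw [b3] at b1
      refine (norm_add_le _ _).trans ?_
      linarith) (by
      intro v hv w hw
      refine ContinuousLinearMap.opNorm_le_bound _ (by positivity) fun x => ?_
      have e : (S + (DΨ₁ (a + S v)).comp S - (S + (DΨ₁ (a + S w)).comp S)) x =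
          (DΨ₁ (a + S v) - DΨ₁ (a + S w)) (S x) := by simp
      rw [e]
      have b1 := hL _ (hSd v hv) _ (hSd w hw)
      rw [add_sub_add_left_eq_sub, ← map_sub, hSn] at b1
      have b2 := ContinuousLinearMap.le_of_opNorm_le _ b1 (S x)
      rwa [hSn] at b2)
  refine ⟨Γ₂, Ψ₂, DΨ₂, h1, by rwa [mul_div_assoc], ?_⟩
  rw [h3]
  ext p
  refine and_congr_left fun hp => ⟨?_, ?_⟩
  · rintro ⟨v, hv, rfl⟩
    refine ⟨a + S v, hSd v hv, ?_⟩
    simp only [← haz]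
    abel
  · rintro ⟨x, hx, rfl⟩
    have hu : x - a ∈ P₁ := P₁.sub_mem hx.1 haP
    have hw : Ψ₁ x - Ψ₁ a ∈ P₁ᗮ := P₁ᗮ.sub_mem (hΨo x hx) (hΨo a ⟨haP, har⟩)
    have hSx : S ⟨T (x - a), hTP' _ hu⟩ = x - a := T.symm_apply_apply _
    refine ⟨⟨T (x - a), hTP' _ hu⟩, ?_, ?_⟩
    · rw [mem_ball_zero_iff, ← hSn, hSx]
      refine (pyth _ hu _ hw).trans_lt ?_
      rw [mem_ball_iff_norm, ← haz] at hp
      have e : z₁ + x + Ψ₁ x - (z₁ + a + Ψ₁ a) = x - a + (Ψ₁ x - Ψ₁ a) := by abel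
      simp only [e] at hp
      linarith
    · simp only [hSx, ← haz, add_sub_cancel]
      abel
end
end

section
/- There exists a constant ĉ > 0 depending only on D such that the following holds. Let M ⊆ H be a compact imbedded D-manifold with infinitesimal reach ≥ 1 and 0 ∈ M. Then there exists a patch Γ of radius ĉ over T₀M centered at 0 such that Γ ⊆ M. -/
open Metric

noncomputable section

variable {H : Type*} [NormedAddCommGroup H] [InnerProductSpace ℝ H]

/-- `M` is a compact imbedded `D`-manifold with parameters `r₁ > r₂ > 0` and
tangent-space assignment `T`. -/
def IsCptManifold (D : ℕ) (M : Set H) (T : H → Submodule ℝ H) (r₁ r₂ : ℝ) : Prop :=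
  IsCompact M ∧ 0 < r₂ ∧ r₂ < r₁ ∧
    ∀ z ∈ M, Module.finrank ℝ (T z) = D ∧
      ∃ (Γ : Set H) (Ψ : H → H) (DΨ : H → H →L[ℝ] H),
        IsPatchRepr (T z) r₁ z Ψ DΨ Γ ∧ DΨ 0 = 0 ∧
        M ∩ Metric.ball z r₂ = Γ ∩ Metric.ball z r₂

/-- `M` has infinitesimal reach at least `ρ`: for every `ρ' < ρ` there are radii
`r₁ > r₂ > 0` such that each point of `M` carries a tangent patch of radius `r₁`
of `Ċ^{1,1}`-norm at most `1/ρ'` representing `M` near that point. -/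
def InfReachGE (M : Set H) (T : H → Submodule ℝ H) (ρ : ℝ) : Prop :=
  ∀ ρ' : ℝ, 0 < ρ' → ρ' < ρ →
    ∃ r₁ r₂ : ℝ, 0 < r₂ ∧ r₂ < r₁ ∧
      ∀ z ∈ M, ∃ (Γ : Set H) (Ψ : H → H) (DΨ : H → H →L[ℝ] H),
        IsPatchRepr (T z) r₁ z Ψ DΨ Γ ∧ DΨ 0 = 0 ∧
        LipschitzOnWith (Real.toNNReal (1 / ρ')) DΨ (patchDom (T z) r₁) ∧
        M ∩ Metric.ball z r₂ = Γ ∩ Metric.ball z r₂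



/-- Uniform local chart of `M` at `p` over the plane `P`. -/
def LocChart (M : Set H) (P : Submodule ℝ H) (p : H) (ε : ℝ) (Ψ : H → H) : Prop :=
  (∀ s ≤ ε, ∀ u ∈ P, ∀ u' ∈ P, ‖u‖ < s → ‖u'‖ < s → ‖Ψ u - Ψ u'‖ ≤ 2 * s * ‖u - u'‖) ∧
  (∀ u ∈ P, ‖u‖ < ε → Ψ u ∈ Pᗮ) ∧ Ψ 0 = 0 ∧
  (∀ u ∈ P, ‖u‖ < ε → p + u + Ψ u ∈ M) ∧
  (∀ q ∈ M, ‖q - p‖ < ε → ∃ u ∈ P, ‖u‖ ≤ ‖q - p‖ ∧ q = p + u + Ψ u)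

/-- One-sided tilt bound: `Q` is within angle `a` of `P`. -/
def TiltLE (P Q : Submodule ℝ H) [P.HasOrthogonalProjection] (a : ℝ) : Prop :=
  ∀ v ∈ Q, ‖v - P.starProjection v‖ ≤ a * ‖v‖

theorem norm_le_of_perp (P : Submodule ℝ H) (u w : H) (hu : u ∈ P) (hw : w ∈ Pᗮ) :
    ‖u‖ ≤ ‖u + w‖ := by
  have h : inner ℝ u w = 0 := hw u hu
  have h2 := norm_add_sq_real u w
  rw [h] at h2
  nlinarith [norm_nonneg u, norm_nonneg w, norm_nonneg (u + w), sq_nonneg ‖w‖]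

theorem exists_charts (M : Set H) (T : H → Submodule ℝ H) (h : InfReachGE M T 1) :
    ∃ ε : ℝ, 0 < ε ∧ ε ≤ 1 / 16 ∧ ∀ p ∈ M, ∃ Ψ, LocChart M (T p) p ε Ψ := by
  obtain ⟨r₁, r₂, h2, h12, hz⟩ := h (1 / 2) (by norm_num) (by norm_num)
  refine ⟨min (1 / 16) (r₂ / 2), by positivity, min_le_left _ _, ?_⟩
  intro p hp
  obtain ⟨Γ, Ψ, DΨ, ⟨hperp, h0, hder, hΓ⟩, hD0, hLip, hM⟩ := hz p hp
  have hz0 : (0 : H) ∈ patchDom (T p) r₁ := ⟨zero_mem _, by simpa using h2.trans h12⟩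
  have hεr : min (1 / 16) (r₂ / 2) ≤ r₂ / 2 := min_le_right _ _
  have hε16 : min (1 / 16) (r₂ / 2) ≤ (1 / 16 : ℝ) := min_le_left _ _
  set ε := min (1 / 16) (r₂ / 2) with hε
  have key : ∀ s ≤ ε, ∀ u ∈ T p, ∀ u' ∈ T p, ‖u‖ < s → ‖u'‖ < s →
      ‖Ψ u - Ψ u'‖ ≤ 2 * s * ‖u - u'‖ := by
    intro s hs u hu u' hu' hus hus'
    have hsub : patchDom (T p) s ⊆ patchDom (T p) r₁ := fun x hx =>
      ⟨hx.1, by have := hx.2; linarith⟩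
    have hconv : Convex ℝ (patchDom (T p) s) := by
      have : patchDom (T p) s = (T p : Set H) ∩ Metric.ball 0 s := by
        ext x; simp [patchDom]
      rw [this]
      exact (T p).convex.inter (convex_ball 0 s)
    refine hconv.norm_image_sub_le_of_norm_hasFDerivWithin_le (f := Ψ) (f' := DΨ)
      (fun x hx => (hder x (hsub hx)).mono hsub) ?_ ⟨hu', hus'⟩ ⟨hu, hus⟩
    intro x hx
    have := hLip.norm_sub_le (hsub hx) hz0
    rw [hD0, sub_zero, sub_zero] at this
    refine this.trans ?_
    have h3 : ((Real.toNNReal (1 / (1 / 2 : ℝ))) : ℝ) = 2 := by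
      rw [Real.coe_toNNReal _ (by norm_num)]; norm_num
    rw [h3]
    have := hx.2
    linarith
  have hεr1 : ε < r₁ := by linarith
  refine ⟨Ψ, key, fun u hu hue => hperp u ⟨hu, hue.trans hεr1⟩, h0, ?_, ?_⟩
  · intro u hu hue
    have h1 := key ε le_rfl u hu 0 (zero_mem _) hue (by
      simpa using lt_of_le_of_lt (norm_nonneg u) hue)
    rw [h0, sub_zero, sub_zero] at h1
    have h3 : ‖Ψ u‖ ≤ ‖u‖ := by nlinarith [norm_nonneg u]
    have : p + u + Ψ u ∈ Γ ∩ Metric.ball p r₂ := by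
      refine ⟨?_, ?_⟩
      · rw [hΓ]; exact ⟨u, ⟨hu, hue.trans hεr1⟩, rfl⟩
      · rw [mem_ball_iff_norm]
        have : p + u + Ψ u - p = u + Ψ u := by abel
        rw [this]
        have := norm_add_le u (Ψ u)
        linarith
    rw [← hM] at this
    exact this.1
  · intro q hq hqp
    have : q ∈ M ∩ Metric.ball p r₂ := ⟨hq, by rw [mem_ball_iff_norm]; linarith⟩
    rw [hM, hΓ] at this
    obtain ⟨⟨u, hu, rfl⟩, -⟩ := this
    refine ⟨u, hu.1, ?_, rfl⟩
    have : p + u + Ψ u - p = u + Ψ u := by abel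
    simp only [this]
    exact norm_le_of_perp (T p) _ _ hu.1 (hperp u hu)

theorem LocChart.quad {M : Set H} {P : Submodule ℝ H} {p : H} {ε : ℝ} {Ψ : H → H}
    (h : LocChart M P p ε Ψ) {u : H} (hu : u ∈ P) (hue : ‖u‖ < ε) :
    ‖Ψ u‖ ≤ 2 * ‖u‖ * ‖u‖ := by
  have key : ∀ s, ‖u‖ < s → s < ε → ‖Ψ u‖ ≤ 2 * s * ‖u‖ := by
    intro s h1 h2
    have := h.1 s h2.le u hu 0 (zero_mem _) h1 (by simpa using lt_of_le_of_lt (norm_nonneg u) h1)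
    simpa [h.2.2.1] using this
  have hc : Filter.Tendsto (fun s : ℝ => 2 * s * ‖u‖) (nhdsWithin ‖u‖ (Set.Ioi ‖u‖))
      (nhds (2 * ‖u‖ * ‖u‖)) := by
    apply Filter.Tendsto.mono_left _ nhdsWithin_le_nhds
    exact Continuous.tendsto (by fun_prop) _
  refine ge_of_tendsto hc ?_
  filter_upwards [Ioo_mem_nhdsGT hue] with s hs
  exact key s hs.1 hs.2

theorem LocChart.eighth {M : Set H} {P : Submodule ℝ H} {p : H} {ε : ℝ} {Ψ : H → H}
    (h : LocChart M P p ε Ψ) (hε : ε ≤ 1 / 16) {u u' : H} (hu : u ∈ P) (hue : ‖u‖ < ε)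
    (hu' : u' ∈ P) (hue' : ‖u'‖ < ε) :
    ‖Ψ u - Ψ u'‖ ≤ 1 / 8 * ‖u - u'‖ := by
  have := h.1 ε le_rfl u hu u' hu' hue hue'
  nlinarith [norm_nonneg (u - u')]

theorem norm_sub_proj_le (P : Submodule ℝ H) [P.HasOrthogonalProjection] (w : H) :
    ‖w - P.starProjection w‖ ≤ ‖w‖ := by
  have h1 : w - P.starProjection w ∈ Pᗮ := P.sub_starProjection_mem_orthogonal w
  have h2 : P.starProjection w ∈ Pᗮᗮ := P.le_orthogonal_orthogonal (P.starProjection_apply_mem w)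
  have := norm_le_of_perp Pᗮ _ _ h1 h2
  simpa using this

theorem norm_proj_le (P : Submodule ℝ H) [P.HasOrthogonalProjection] (w : H) :
    ‖P.starProjection w‖ ≤ ‖w‖ := by
  have h1 : w - P.starProjection w ∈ Pᗮ := P.sub_starProjection_mem_orthogonal w
  have := norm_le_of_perp P _ _ (P.starProjection_apply_mem w) h1
  simpa using this

/-- Tangent planes at nearby points are close. -/
theorem tilt_near {M : Set H} {P Q : Submodule ℝ H} [P.HasOrthogonalProjection]
    {p q : H} {ε : ℝ} {Ψ Φ : H → H} (hq : q ∈ M)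
    (hP : LocChart M P p ε Ψ) (hQ : LocChart M Q q ε Φ) (hpq : ‖q - p‖ < ε) :
    TiltLE P Q (2 * ‖q - p‖) := by
  intro v hv
  have hε : 0 < ε := lt_of_le_of_lt (norm_nonneg _) hpq
  obtain ⟨x, hx, hxn, hxq⟩ := hP.2.2.2.2 q hq hpq
  have hcont : Filter.Tendsto
      (fun t : ℝ => 2 * (‖q - p‖ + t * ‖v‖ + 2 * t * t * ‖v‖ * ‖v‖ + t)
        * (‖v‖ + 2 * t * ‖v‖ * ‖v‖) + 2 * t * ‖v‖ * ‖v‖)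
      (nhdsWithin 0 (Set.Ioi 0)) (nhds (2 * ‖q - p‖ * ‖v‖)) := by
    apply Filter.Tendsto.mono_left _ nhdsWithin_le_nhds
    have : Continuous (fun t : ℝ => 2 * (‖q - p‖ + t * ‖v‖ + 2 * t * t * ‖v‖ * ‖v‖ + t)
        * (‖v‖ + 2 * t * ‖v‖ * ‖v‖) + 2 * t * ‖v‖ * ‖v‖) := by fun_prop
    have h := this.tendsto 0
    simpa using h
  have hsm : ∀ᶠ t : ℝ in nhdsWithin 0 (Set.Ioi 0),
      ‖q - p‖ + t * ‖v‖ + 2 * t * t * ‖v‖ * ‖v‖ + t < ε := by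
    apply Filter.Eventually.filter_mono nhdsWithin_le_nhds
    have : Continuous (fun t : ℝ => ‖q - p‖ + t * ‖v‖ + 2 * t * t * ‖v‖ * ‖v‖ + t) := by fun_prop
    exact this.tendsto 0 |>.eventually_lt_const (by simpa using hpq)
  refine ge_of_tendsto hcont ?_
  filter_upwards [hsm, self_mem_nhdsWithin] with t hts ht
  have ht : 0 < t := ht
  have hnt : ‖t • v‖ = t * ‖v‖ := by rw [norm_smul, Real.norm_eq_abs, abs_of_pos ht]
  have hv0 := norm_nonneg v
  have htv : 0 ≤ t * ‖v‖ := by positivity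
  have htv2 : 0 ≤ 2 * t * t * ‖v‖ * ‖v‖ := by positivity
  have hqp0 := norm_nonneg (q - p)
  have htve : ‖t • v‖ < ε := by rw [hnt]; linarith
  have hw := hQ.2.2.2.1 (t • v) (Q.smul_mem t hv) htve
  have hΦ := hQ.quad (Q.smul_mem t hv) htve
  rw [hnt] at hΦ
  have hwp : ‖q + t • v + Φ (t • v) - p‖ ≤ ‖q - p‖ + t * ‖v‖ + 2 * t * t * ‖v‖ * ‖v‖ := by
    have : q + t • v + Φ (t • v) - p = (q - p) + t • v + Φ (t • v) := by abel
    rw [this]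
    have := norm_add₃_le (a := q - p) (b := t • v) (c := Φ (t • v))
    rw [hnt] at this
    linarith
  obtain ⟨y, hy, hyn, hyq⟩ := hP.2.2.2.2 _ hw (by linarith)
  set s := ‖q - p‖ + t * ‖v‖ + 2 * t * t * ‖v‖ * ‖v‖ + t with hs
  have hdiff := hP.1 s hts.le y hy x hx (by linarith) (by linarith)
  have hPy : Ψ y ∈ Pᗮ := hP.2.1 y hy (by linarith)
  have hPx : Ψ x ∈ Pᗮ := hP.2.1 x hx (by linarith)
  have hyq2 : t • v + Φ (t • v) = (y - x) + (Ψ y - Ψ x) := by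
    have : q + t • v + Φ (t • v) - q = (p + y + Ψ y) - (p + x + Ψ x) := by rw [hyq, ← hxq]
    calc _ = q + t • v + Φ (t • v) - q := by abel
      _ = _ := this
      _ = _ := by abel
  have hyx : ‖y - x‖ ≤ t * ‖v‖ + 2 * t * t * ‖v‖ * ‖v‖ := by
    refine (norm_le_of_perp P _ _ (P.sub_mem hy hx) (Pᗮ.sub_mem hPy hPx)).trans ?_
    rw [← hyq2]
    have := norm_add_le (t • v) (Φ (t • v))
    rw [hnt] at this
    linarith
  have hproj : P.starProjection (t • v + Φ (t • v)) = y - x := by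
    rw [hyq2, map_add, Submodule.starProjection_eq_self_iff.2 (P.sub_mem hy hx),
      (Submodule.starProjection_apply_eq_zero_iff P).2 (Pᗮ.sub_mem hPy hPx), add_zero]
  have hperp : t • (v - P.starProjection v) = (Ψ y - Ψ x) -
      (Φ (t • v) - P.starProjection (Φ (t • v))) := by
    rw [map_add, map_smul] at hproj
    have h1 : Ψ y - Ψ x = t • v + Φ (t • v) - (y - x) := by rw [hyq2]; abel
    rw [h1, ← hproj, smul_sub]
    abel
  have hfin : t * ‖v - P.starProjection v‖ ≤
      2 * s * (t * ‖v‖ + 2 * t * t * ‖v‖ * ‖v‖) + 2 * t * t * ‖v‖ * ‖v‖ := by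
    have h1 : ‖t • (v - P.starProjection v)‖ = t * ‖v - P.starProjection v‖ := by
      rw [norm_smul, Real.norm_eq_abs, abs_of_pos ht]
    rw [← h1, hperp]
    refine (norm_sub_le _ _).trans ?_
    have h2 := norm_sub_proj_le P (Φ (t • v))
    have hs0 : 0 ≤ s := by positivity
    have h3 : 2 * s * ‖y - x‖ ≤ 2 * s * (t * ‖v‖ + 2 * t * t * ‖v‖ * ‖v‖) := by gcongr
    linarith
  refine le_of_mul_le_mul_left (hfin.trans (le_of_eq ?_)) ht
  ring

theorem TiltLE.trans {P Q R : Submodule ℝ H} [P.HasOrthogonalProjection]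
    [Q.HasOrthogonalProjection] {a b : ℝ} (ha : 0 ≤ a) (h1 : TiltLE P Q a) (h2 : TiltLE Q R b) :
    TiltLE P R (a + b) := by
  intro v hv
  have h3 := h1 _ (Q.starProjection_apply_mem v)
  have h4 := h2 v hv
  have h5 := norm_proj_le Q v
  have h6 := norm_sub_proj_le P (v - Q.starProjection v)
  have h7 : v - P.starProjection v = (Q.starProjection v - P.starProjection (Q.starProjection v))
      + ((v - Q.starProjection v) - P.starProjection (v - Q.starProjection v)) := by
    rw [map_sub]; abel
  rw [h7]
  refine (norm_add_le _ _).trans ?_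
  nlinarith

theorem TiltLE.lower {P Q : Submodule ℝ H} [P.HasOrthogonalProjection]
    (h : TiltLE P Q (1 / 8)) {v : H} (hv : v ∈ Q) : 7 / 8 * ‖v‖ ≤ ‖P.starProjection v‖ := by
  have h1 := h v hv
  have h2 := norm_sub_norm_le v (P.starProjection v)
  linarith

/-- Cone condition. -/
theorem cone {M : Set H} {P Q : Submodule ℝ H} [P.HasOrthogonalProjection]
    {p q q' : H} {ε : ℝ} {Φ : H → H} (hε : ε ≤ 1 / 16)
    (hQ : LocChart M Q p ε Φ) (ht : TiltLE P Q (1 / 8))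
    (hq : q ∈ M) (hq' : q' ∈ M) (hn : ‖q - p‖ < ε) (hn' : ‖q' - p‖ < ε) :
    ‖(q - q') - P.starProjection (q - q')‖ ≤ ‖P.starProjection (q - q')‖ := by
  obtain ⟨u, hu, hun, huq⟩ := hQ.2.2.2.2 q hq hn
  obtain ⟨u', hu', hun', huq'⟩ := hQ.2.2.2.2 q' hq' hn'
  have h8 := hQ.eighth hε hu (hun.trans_lt hn) hu' (hun'.trans_lt hn')
  have hd : q - q' = (u - u') + (Φ u - Φ u') := by rw [huq, huq']; abel
  have hm := Q.sub_mem hu hu'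
  have h1 := ht _ hm
  have h2 := ht.lower hm
  rw [hd, map_add]
  have h3 := norm_sub_proj_le P (Φ u - Φ u')
  have h4 := norm_proj_le P (Φ u - Φ u')
  have h5 := norm_sub_le_norm_add (P.starProjection (u - u')) (P.starProjection (Φ u - Φ u'))
  have h6 : (u - u') + (Φ u - Φ u') - (P.starProjection (u - u') + P.starProjection (Φ u - Φ u'))
    = ((u - u') - P.starProjection (u - u')) +
      ((Φ u - Φ u') - P.starProjection (Φ u - Φ u')) := by abel
  rw [h6]
  have h7 := norm_add_le ((u - u') - P.starProjection (u - u'))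
      ((Φ u - Φ u') - P.starProjection (Φ u - Φ u'))
  have := norm_nonneg (u - u')
  linarith

/-- The projection between two planes of equal dimension and small tilt is bijective. -/
theorem exists_equiv {P Q : Submodule ℝ H} [FiniteDimensional ℝ P] [FiniteDimensional ℝ Q]
    (hf : Module.finrank ℝ Q = Module.finrank ℝ P) (ht : TiltLE P Q (1 / 8)) :
    ∃ E : Q ≃ₗ[ℝ] P, ∀ u : Q, (E u : H) = P.starProjection (u : H) := by
  let A : Q →ₗ[ℝ] P := (P.orthogonalProjection : H →L[ℝ] P).toLinearMap ∘ₗ Q.subtype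
  have hA : ∀ u : Q, (A u : H) = P.starProjection (u : H) := fun u => rfl
  have hinj : Function.Injective A := by
    rw [injective_iff_map_eq_zero]
    intro u hu
    have h1 := ht.lower u.2
    rw [← hA, hu] at h1
    simp only [ZeroMemClass.coe_zero, norm_zero] at h1
    have : ‖(u : H)‖ = 0 := le_antisymm (by linarith) (norm_nonneg _)
    simpa using this
  exact ⟨LinearEquiv.ofInjectiveOfFinrankEq A hinj hf, fun u => hA u⟩

theorem exists_over {M : Set H} {P Q : Submodule ℝ H} [FiniteDimensional ℝ P]
    [FiniteDimensional ℝ Q]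
    (hf : Module.finrank ℝ Q = Module.finrank ℝ P)
    {p : H} {ε : ℝ} {Φ : H → H} (hε0 : 0 < ε) (hε : ε ≤ 1 / 16)
    (hQ : LocChart M Q p ε Φ) (ht : TiltLE P Q (1 / 8))
    {y : H} (hy : y ∈ P) (hyn : ‖y - P.starProjection p‖ ≤ ε / 32) :
    ∃ q ∈ M, P.starProjection q = y ∧ ‖q - p‖ ≤ ε / 4 := by
  obtain ⟨E, hE⟩ := exists_equiv hf ht
  let F : Q → P := fun u => P.orthogonalProjection ((u : H) + Φ u)
  let A : Q →L[ℝ] P := E.toLinearMap.toContinuousLinearMap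
  have hA : ∀ u, A u = E u := fun u => rfl
  let g : A.NonlinearRightInverse :=
    { toFun := fun y => E.symm y
      nnnorm := 2
      bound' := by
        intro y
        have := ht.lower (E.symm y).2
        rw [← hE, E.apply_symm_apply] at this
        have h2 : 0 ≤ ‖(E.symm y : H)‖ := norm_nonneg _
        show ‖(E.symm y : H)‖ ≤ 2 * ‖(y : H)‖
        linarith
      right_inv' := fun y => by rw [hA]; exact E.apply_symm_apply y }
  have hFA : ApproximatesLinearOn F A (Metric.closedBall (0 : Q) (ε / 8)) (1 / 8) := by
    intro u hu u' hu'
    rw [mem_closedBall_zero_iff] at hu hu'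
    have h8 := hQ.eighth hε u.2 (lt_of_le_of_lt hu (by linarith)) u'.2
      (lt_of_le_of_lt hu' (by linarith))
    have h1 : ((F u - F u' - A (u - u') : P) : H) = P.starProjection (Φ u - Φ u') := by
      have : ((F u - F u' - A (u - u') : P) : H) = P.starProjection ((u : H) + Φ u) -
        P.starProjection ((u' : H) + Φ u') - P.starProjection ((u - u' : Q) : H) := by
        rw [← hE]; rfl
      rw [this, ← map_sub, ← map_sub]
      congr 1
      push_cast
      abel
    have h2 : ‖F u - F u' - A (u - u')‖ = ‖P.starProjection (Φ u - Φ u')‖ := by rw [← h1]; rfl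
    rw [h2]
    refine (norm_proj_le _ _).trans (h8.trans (le_of_eq ?_))
    push_cast
    rfl
  have hsurj := hFA.surjOn_closedBall_of_nonlinearRightInverse g (ε := ε / 8) (b := 0)
    (by positivity) subset_rfl
  have hF0 : F 0 = 0 := by simp [F, hQ.2.2.1]
  rw [hF0] at hsurj
  have hmem : (⟨y, hy⟩ - P.orthogonalProjection p : P) ∈ Metric.closedBall (0 : P)
      (((g.nnnorm : ℝ)⁻¹ - ((1 / 8 : NNReal) : ℝ)) * (ε / 8)) := by
    rw [mem_closedBall_zero_iff]
    have h1 : ‖(⟨y, hy⟩ - P.orthogonalProjection p : P)‖ = ‖y - P.starProjection p‖ := rfl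
    have h2 : (g.nnnorm : ℝ) = 2 := rfl
    rw [h1, h2]
    push_cast
    linarith
  obtain ⟨u, hu, huF⟩ := hsurj hmem
  rw [mem_closedBall_zero_iff] at hu
  have hu : ‖(u : H)‖ ≤ ε / 8 := hu
  have hue : ‖(u : H)‖ < ε := by linarith
  refine ⟨p + u + Φ u, hQ.2.2.2.1 u u.2 hue, ?_, ?_⟩
  · have h1 := congrArg (Subtype.val) huF
    have h2 : P.starProjection ((u : H) + Φ u) = y - P.starProjection p := h1
    rw [add_assoc, map_add, h2]
    abel
  · have h3 := hQ.quad u.2 hue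
    have h4 : p + u + Φ u - p = u + Φ u := by abel
    rw [h4]
    have h5 := norm_add_le (u : H) (Φ u)
    nlinarith [norm_nonneg (u : H)]

theorem lip_chain {s : Set H} (hs : Convex ℝ s) {δ : ℝ} (hδ : 0 < δ) {f : H → H}
    (h : ∀ x ∈ s, ∀ y ∈ s, ‖x - y‖ ≤ δ → ‖f x - f y‖ ≤ ‖x - y‖) :
    ∀ x ∈ s, ∀ y ∈ s, ‖f x - f y‖ ≤ ‖x - y‖ := by
  have key : ∀ n : ℕ, ∀ x ∈ s, ∀ y ∈ s, ‖x - y‖ ≤ n * δ → ‖f x - f y‖ ≤ ‖x - y‖ := by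
    intro n
    induction n with
    | zero => 
      intro x hx y hy hxy
      exact h x hx y hy (by simp at hxy; simp [hxy, hδ.le])
    | succ n ih =>
      intro x hx y hy hxy
      have hn : (0 : ℝ) < n + 1 := by positivity
      have ha : 0 ≤ (n : ℝ) / (n + 1) := by positivity
      have hb : 0 ≤ 1 / ((n : ℝ) + 1) := by positivity
      have hab : 1 / ((n : ℝ) + 1) + (n : ℝ) / (n + 1) = 1 := by field_simp; ring
      have hz := hs hx hy hb ha hab
      set a := (n : ℝ) / (n + 1) with hadef
      set b := 1 / ((n : ℝ) + 1) with hbdef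
      have e1 : x - (b • x + a • y) = a • (x - y) := by
        have : x = (b + a) • x := by rw [hab, one_smul]
        nth_rewrite 1 [this]
        rw [add_smul, smul_sub]; abel
      have e2 : (b • x + a • y) - y = b • (x - y) := by
        have : y = (b + a) • y := by rw [hab, one_smul]
        nth_rewrite 2 [this]
        rw [add_smul, smul_sub]; abel
      have n1 : ‖x - (b • x + a • y)‖ = a * ‖x - y‖ := by
        rw [e1, norm_smul, Real.norm_eq_abs, abs_of_nonneg ha]
      have n2 : ‖(b • x + a • y) - y‖ = b * ‖x - y‖ := by
        rw [e2, norm_smul, Real.norm_eq_abs, abs_of_nonneg hb]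
      push_cast at hxy
      have l1 : a * ‖x - y‖ ≤ n * δ := by
        calc a * ‖x - y‖ ≤ a * ((n + 1) * δ) := by gcongr
          _ = n * δ := by rw [hadef]; field_simp
      have l2 : b * ‖x - y‖ ≤ δ := by
        calc b * ‖x - y‖ ≤ b * ((n + 1) * δ) := by gcongr
          _ = δ := by rw [hbdef]; field_simp
      have m1 := ih x hx _ hz (by rw [n1]; exact l1)
      have m2 := h _ hz y hy (by rw [n2]; exact l2)
      rw [n1] at m1
      rw [n2] at m2
      calc ‖f x - f y‖ ≤ ‖f x - f (b • x + a • y)‖ + ‖f (b • x + a • y) - f y‖ :=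
            norm_sub_le_norm_sub_add_norm_sub _ _ _
        _ ≤ a * ‖x - y‖ + b * ‖x - y‖ := add_le_add m1 m2
        _ = (b + a) * ‖x - y‖ := by ring
        _ = ‖x - y‖ := by rw [hab, one_mul]
  intro x hx y hy
  obtain ⟨n, hn⟩ := exists_nat_ge (‖x - y‖ / δ)
  exact key n x hx y hy (by rwa [div_le_iff₀ hδ] at hn)

/-- Lipschitz graph over the closed ball of radius `R` inside `M`. -/
def GoodGraph (M : Set H) (P : Submodule ℝ H) (R : ℝ) (Ψ : H → H) : Prop :=
  (∀ x ∈ P, ‖x‖ ≤ R → Ψ x ∈ Pᗮ) ∧ Ψ 0 = 0 ∧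
  (∀ x ∈ P, ‖x‖ ≤ R → ∀ y ∈ P, ‖y‖ ≤ R → ‖Ψ x - Ψ y‖ ≤ ‖x - y‖) ∧
  (∀ x ∈ P, ‖x‖ ≤ R → x + Ψ x ∈ M)

theorem GoodGraph.dist {M : Set H} {P : Submodule ℝ H} {R : ℝ} {Ψ : H → H}
    (h : GoodGraph M P R Ψ) {x y : H} (hx : x ∈ P) (hxR : ‖x‖ ≤ R) (hy : y ∈ P) (hyR : ‖y‖ ≤ R) :
    ‖(x + Ψ x) - (y + Ψ y)‖ ≤ 2 * ‖x - y‖ := by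
  have h1 := h.2.2.1 x hx hxR y hy hyR
  have : (x + Ψ x) - (y + Ψ y) = (x - y) + (Ψ x - Ψ y) := by abel
  rw [this]
  have := norm_add_le (x - y) (Ψ x - Ψ y)
  linarith

theorem GoodGraph.proj {M : Set H} {P : Submodule ℝ H} [P.HasOrthogonalProjection]
    {R : ℝ} {Ψ : H → H} (h : GoodGraph M P R Ψ) {x : H} (hx : x ∈ P) (hxR : ‖x‖ ≤ R) :
    P.starProjection (x + Ψ x) = x := by
  rw [map_add, Submodule.starProjection_eq_self_iff.2 hx,
      (Submodule.starProjection_apply_eq_zero_iff P).2 (h.1 x hx hxR), add_zero]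

theorem GoodGraph.tilt {M : Set H} {T : H → Submodule ℝ H}
    (hfd : ∀ z ∈ M, FiniteDimensional ℝ (T z)) [FiniteDimensional ℝ (T 0)]
    {ε : ℝ} (hε : 0 < ε) (hch : ∀ p ∈ M, ∃ Φ, LocChart M (T p) p ε Φ)
    {R : ℝ} {Ψ : H → H} (h : GoodGraph M (T 0) R Ψ) :
    ∀ x ∈ T 0, ‖x‖ ≤ R → TiltLE (T 0) (T (x + Ψ x)) (4 * ‖x‖) := by
  have key : ∀ n : ℕ, ∀ x ∈ T 0, ‖x‖ ≤ R → ‖x‖ ≤ n * (ε / 4) →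
      TiltLE (T 0) (T (x + Ψ x)) (4 * ‖x‖) := by
    intro n
    induction n with
    | zero =>
      intro x hx hxR hxn
      have hx0 : x = 0 := by simpa using hxn
      subst hx0
      intro v hv
      have hv' : v ∈ T 0 := by simpa [h.2.1] using hv
      rw [Submodule.starProjection_eq_self_iff.2 hv']
      simp
    | succ n ih =>
      intro x hx hxR hxn
      have hn : (0 : ℝ) < n + 1 := by positivity
      set a := (n : ℝ) / (n + 1) with hadef
      have ha : 0 ≤ a := by positivity
      have ha1 : a ≤ 1 := by rw [hadef, div_le_one hn]; linarith
      have hax : ‖a • x‖ = a * ‖x‖ := by rw [norm_smul, Real.norm_eq_abs, abs_of_nonneg ha]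
      have haxR : ‖a • x‖ ≤ R := by
        rw [hax]; nlinarith [norm_nonneg x]
      have hxa : ‖x - a • x‖ = (1 - a) * ‖x‖ := by
        have : x - a • x = (1 - a) • x := by rw [sub_smul, one_smul]
        rw [this, norm_smul, Real.norm_eq_abs, abs_of_nonneg (by linarith)]
      have hm := (T 0).smul_mem a hx
      push_cast at hxn
      have h1 := ih (a • x) hm haxR (by
        rw [hax]
        calc a * ‖x‖ ≤ a * ((n + 1) * (ε / 4)) := by gcongr
          _ = n * (ε / 4) := by rw [hadef]; field_simp)
      have hd := h.dist hx hxR hm haxR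
      have hsm : (1 - a) * ‖x‖ ≤ ε / 4 := by
        have : 1 - a = 1 / (n + 1) := by rw [hadef]; field_simp; ring
        rw [this]
        calc 1 / ((n : ℝ) + 1) * ‖x‖ ≤ 1 / ((n : ℝ) + 1) * ((n + 1) * (ε / 4)) := by gcongr
          _ = ε / 4 := by field_simp
      rw [hxa] at hd
      have hp := h.2.2.2 _ hm haxR
      have hq := h.2.2.2 _ hx hxR
      obtain ⟨Φ, hΦ⟩ := hch _ hp
      obtain ⟨Φ', hΦ'⟩ := hch _ hq
      haveI := hfd _ hp
      have h2 := tilt_near hq hΦ hΦ' (by linarith)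
      have h3 := TiltLE.trans (by positivity) h1 h2
      intro v hv
      refine (h3 v hv).trans ?_
      apply mul_le_mul_of_nonneg_right _ (norm_nonneg v)
      rw [hax]
      linarith
  intro x hx hxR
  obtain ⟨n, hn⟩ := exists_nat_ge (‖x‖ / (ε / 4))
  exact key n x hx hxR (by rwa [div_le_iff₀ (by positivity)] at hn)

theorem GoodGraph.extend {M : Set H} {T : H → Submodule ℝ H} {D : ℕ}
    (hfd : ∀ z ∈ M, FiniteDimensional ℝ (T z)) [FiniteDimensional ℝ (T 0)]
    (hD : ∀ z ∈ M, Module.finrank ℝ (T z) = D) (h0M : (0 : H) ∈ M)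
    {ε : ℝ} (hε : 0 < ε) (hε16 : ε ≤ 1 / 16) (hch : ∀ p ∈ M, ∃ Φ, LocChart M (T p) p ε Φ)
    {R : ℝ} {Ψ : H → H} (hR : 0 ≤ R) (hR32 : R ≤ 1 / 32) (h : GoodGraph M (T 0) R Ψ) :
    ∃ Ψ', GoodGraph M (T 0) (R + ε / 32) Ψ' := by
  set δ := ε / 32 with hδ
  have hδ0 : 0 < δ := by positivity
  have hRδ : 0 < R + δ := by positivity
  set a := R / (R + δ) with hadef
  have ha : 0 ≤ a := by positivity
  have ha1 : a ≤ 1 := by rw [hadef, div_le_one hRδ]; linarith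
  have hnorm : ∀ y : H, ‖a • y‖ = a * ‖y‖ := fun y => by
    rw [norm_smul, Real.norm_eq_abs, abs_of_nonneg ha]
  have haR : ∀ y : H, ‖y‖ ≤ R + δ → ‖a • y‖ ≤ R := by
    intro y hy
    rw [hnorm]
    calc a * ‖y‖ ≤ a * (R + δ) := by gcongr
      _ = R := by rw [hadef]; field_simp
  have hya : ∀ y : H, ‖y‖ ≤ R + δ → ‖y - a • y‖ ≤ δ := by
    intro y hy
    have : y - a • y = (1 - a) • y := by rw [sub_smul, one_smul]
    rw [this, norm_smul, Real.norm_eq_abs, abs_of_nonneg (by linarith)]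
    calc (1 - a) * ‖y‖ ≤ (1 - a) * (R + δ) := by
            apply mul_le_mul_of_nonneg_left hy; linarith
      _ = δ := by rw [hadef]; field_simp; ring
  have htilt : ∀ x ∈ T 0, ‖x‖ ≤ R → TiltLE (T 0) (T (x + Ψ x)) (1 / 8) := by
    intro x hx hxR v hv
    refine (h.tilt hfd hε hch x hx hxR v hv).trans ?_
    apply mul_le_mul_of_nonneg_right _ (norm_nonneg v)
    linarith
  have hex : ∀ y : H, ∃ q : H, y ∈ T 0 → ‖y‖ ≤ R + δ →
      q ∈ M ∧ (T 0).starProjection q = y ∧ ‖q - (a • y + Ψ (a • y))‖ ≤ ε / 4 := by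
    intro y
    by_cases hy : y ∈ T 0 ∧ ‖y‖ ≤ R + δ
    · have hm := (T 0).smul_mem a hy.1
      have hp := h.2.2.2 _ hm (haR y hy.2)
      obtain ⟨Φ, hΦ⟩ := hch _ hp
      haveI := hfd _ hp
      obtain ⟨q, hq⟩ := exists_over (P := T 0) ((hD _ hp).trans (hD _ h0M).symm) hε hε16 hΦ
        (htilt _ hm (haR y hy.2)) hy.1 (by rw [h.proj hm (haR y hy.2)]; exact hya y hy.2)
      exact ⟨q, fun _ _ => hq⟩
    · exact ⟨0, fun h1 h2 => absurd ⟨h1, h2⟩ hy⟩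
  choose q hq using hex
  have hcone : ∀ y ∈ T 0, ‖y‖ ≤ R + δ → ∀ z ∈ M, ‖z - (a • y + Ψ (a • y))‖ < ε →
      ‖(q y - z) - (T 0).starProjection (q y - z)‖ ≤ ‖(T 0).starProjection (q y - z)‖ := by
    intro y hy hyR z hz hzn
    have hm := (T 0).smul_mem a hy
    have hp := h.2.2.2 _ hm (haR y hyR)
    obtain ⟨Φ, hΦ⟩ := hch _ hp
    obtain ⟨h1, h2, h3⟩ := hq y hy hyR
    exact cone hε16 hΦ (htilt _ hm (haR y hyR)) h1 hz (by linarith) hzn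
  refine ⟨fun y => q y - y, ?_, ?_, ?_, ?_⟩
  · intro y hy hyR
    have h1 := (T 0).sub_starProjection_mem_orthogonal (q y)
    rwa [(hq y hy hyR).2.1] at h1
  · have h1 := hcone 0 (zero_mem _) (by simpa using hRδ.le) 0 h0M (by simpa [h.2.1] using hε)
    obtain ⟨-, h2, -⟩ := hq 0 (zero_mem _) (by simpa using hRδ.le)
    rw [sub_zero, h2] at h1
    simpa using h1
  · have hconv : Convex ℝ ((T 0 : Set H) ∩ Metric.closedBall 0 (R + δ)) :=
      (T 0).convex.inter (convex_closedBall 0 _)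
    have := lip_chain hconv hδ0 (f := fun y => q y - y) (by
      intro y hy y' hy' hyy
      have hyR : ‖y‖ ≤ R + δ := by simpa using hy.2
      have hyR' : ‖y'‖ ≤ R + δ := by simpa using hy'.2
      have hy := hy.1
      have hy' := hy'.1
      obtain ⟨h1, h2, h3⟩ := hq y hy hyR
      obtain ⟨h1', h2', h3'⟩ := hq y' hy' hyR'
      have hdist := h.dist ((T 0).smul_mem a hy') (haR y' hyR') ((T 0).smul_mem a hy) (haR y hyR)
      rw [← smul_sub, hnorm, norm_sub_rev] at hdist
      have hc := hcone y hy hyR (q y') h1' (by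
        have e := norm_sub_le_norm_sub_add_norm_sub (q y') (a • y' + Ψ (a • y'))
          (a • y + Ψ (a • y))
        rw [norm_sub_rev (a • y + Ψ (a • y))] at hdist
        have : a * ‖y' - y‖ ≤ δ := by
          rw [norm_sub_rev]
          nlinarith [norm_nonneg (y - y')]
        linarith)
      rw [map_sub, h2, h2'] at hc
      have : q y - y - (q y' - y') = q y - q y' - (y - y') := by abel
      simpa only [this] using hc)
    intro x hx hxR y hy hyR
    exact this x ⟨hx, by simpa using hxR⟩ y ⟨hy, by simpa using hyR⟩
  · intro y hy hyR
    have := (hq y hy hyR).1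
    simpa using this

theorem GoodGraph.deriv {M : Set H} {T : H → Submodule ℝ H} {D : ℕ}
    (hfd : ∀ z ∈ M, FiniteDimensional ℝ (T z)) [FiniteDimensional ℝ (T 0)]
    (hD : ∀ z ∈ M, Module.finrank ℝ (T z) = D) (h0M : (0 : H) ∈ M)
    {ε : ℝ} (hε : 0 < ε) (hch : ∀ p ∈ M, ∃ Φ, LocChart M (T p) p ε Φ)
    {R : ℝ} {Ψ : H → H} (hR32 : 1 / 32 ≤ R) (h : GoodGraph M (T 0) R Ψ)
    {y : H} (hy : y ∈ patchDom (T 0) (1 / 32)) :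
    ∃ B : H →L[ℝ] H, HasFDerivWithinAt Ψ B (patchDom (T 0) (1 / 32)) y := by
  obtain ⟨hyP, hyn⟩ := hy
  have hyR : ‖y‖ ≤ R := by linarith
  have hqM := h.2.2.2 y hyP hyR
  have htilt : TiltLE (T 0) (T (y + Ψ y)) (1 / 8) := by
    intro v hv
    refine (h.tilt hfd hε hch y hyP hyR v hv).trans ?_
    apply mul_le_mul_of_nonneg_right _ (norm_nonneg v)
    linarith
  obtain ⟨Φ, hΦ⟩ := hch _ hqM
  haveI := hfd _ hqM
  obtain ⟨E, hE⟩ := exists_equiv (P := T 0) ((hD _ hqM).trans (hD _ h0M).symm) htilt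
  let B : H →L[ℝ] H := (ContinuousLinearMap.id ℝ H - (T 0).starProjection) ∘L
    (T (y + Ψ y)).subtypeL ∘L E.symm.toLinearMap.toContinuousLinearMap ∘L
      (T 0).orthogonalProjection
  have hB : ∀ u ∈ T (y + Ψ y), B ((T 0).starProjection u) = u - (T 0).starProjection u := by
    intro u hu
    have h1 : (T 0).orthogonalProjection ((T 0).starProjection u) = E ⟨u, hu⟩ := by
      apply Subtype.ext
      rw [hE]
      exact Submodule.starProjection_eq_self_iff.2 ((T 0).starProjection_apply_mem u)
    have h2 : B ((T 0).starProjection u) =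
        (ContinuousLinearMap.id ℝ H - (T 0).starProjection)
          (E.symm ((T 0).orthogonalProjection ((T 0).starProjection u)) : H) := rfl
    rw [h2, h1, E.symm_apply_apply]
    rfl
  refine ⟨B, ?_⟩
  have hbound : ∀ y' ∈ patchDom (T 0) (1 / 32), ‖y' - y‖ < ε / 2 →
      ‖Ψ y' - Ψ y - B (y' - y)‖ ≤ (8 * (1 + ‖B‖)) * ‖‖y' - y‖ ^ 2‖ := by
    intro y' hy' hd
    obtain ⟨hyP', hyn'⟩ := hy'
    have hyR' : ‖y'‖ ≤ R := by linarith
    have hqM' := h.2.2.2 y' hyP' hyR'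
    have hdist := h.dist hyP' hyR' hyP hyR
    obtain ⟨u, hu, hun, huq⟩ := hΦ.2.2.2.2 _ hqM' (by linarith)
    have hquad := hΦ.quad hu (by linarith)
    have e0 : (y' - y) + (Ψ y' - Ψ y) = u + Φ u := by
      calc (y' - y) + (Ψ y' - Ψ y) = (y' + Ψ y') - (y + Ψ y) := by abel
        _ = u + Φ u := by rw [huq]; abel
    have e1 : y' - y = (T 0).starProjection u + (T 0).starProjection (Φ u) := by
      have h1 := h.proj hyP' hyR'
      have h2 := h.proj hyP hyR
      rw [← map_add, ← e0]
      rw [show (y' - y) + (Ψ y' - Ψ y) = (y' + Ψ y') - (y + Ψ y) by abel, map_sub, h1, h2]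
    have e2 : Ψ y' - Ψ y - B (y' - y) =
        (Φ u - (T 0).starProjection (Φ u)) - B ((T 0).starProjection (Φ u)) := by
      have : Ψ y' - Ψ y = u + Φ u - (y' - y) := by rw [← e0]; abel
      rw [this, e1, map_add, hB u hu]
      abel
    rw [e2]
    have f1 := norm_sub_proj_le (T 0) (Φ u)
    have f2 := (B.le_opNorm ((T 0).starProjection (Φ u))).trans
      (mul_le_mul_of_nonneg_left (norm_proj_le (T 0) (Φ u)) (norm_nonneg B))
    have f3 := norm_sub_le (Φ u - (T 0).starProjection (Φ u)) (B ((T 0).starProjection (Φ u)))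
    have hu2 : ‖u‖ ≤ 2 * ‖y' - y‖ := hun.trans hdist
    have f4 : ‖Φ u‖ ≤ 8 * ‖y' - y‖ ^ 2 := by nlinarith [norm_nonneg u]
    rw [Real.norm_of_nonneg (by positivity)]
    calc _ ≤ (1 + ‖B‖) * ‖Φ u‖ := by linarith
      _ ≤ (1 + ‖B‖) * (8 * ‖y' - y‖ ^ 2) := by gcongr
      _ = _ := by ring
  apply HasFDerivWithinAt.of_isLittleO
  have hO : (fun x' => Ψ x' - Ψ y - B (x' - y)) =O[nhdsWithin y (patchDom (T 0) (1 / 32))]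
      fun x' => ‖x' - y‖ ^ 2 := by
    apply Asymptotics.IsBigO.of_bound (8 * (1 + ‖B‖))
    filter_upwards [self_mem_nhdsWithin,
      mem_nhdsWithin_of_mem_nhds (Metric.ball_mem_nhds y (half_pos hε))] with y' h1 h2
    exact hbound y' h1 (by simpa [dist_eq_norm] using h2)
  refine hO.trans_isLittleO ?_
  have : (fun x' : H => ‖x' - y‖ ^ 2) =o[nhds y] fun x' => x' - y :=
    Asymptotics.isLittleO_pow_sub_sub y one_lt_two
  exact this.mono nhdsWithin_le_nhds

/-- **Existence of a patch of definite size.** There is a constant `ĉ > 0`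
depending only on `D` such that any compact imbedded `D`-manifold `M` with
infinitesimal reach at least `1` and `0 ∈ M` contains a patch of radius `ĉ`
over `T₀M` centered at `0`. -/
theorem patch_of_definite_size (D : ℕ) (hD : 0 < D) :
    ∃ chat : ℝ, 0 < chat ∧
      ∀ (H : Type) [NormedAddCommGroup H] [InnerProductSpace ℝ H] [CompleteSpace H],
        (D : Cardinal) < Module.rank ℝ H →
      ∀ (M : Set H) (T : H → Submodule ℝ H) (r₁ r₂ : ℝ),
        IsCptManifold D M T r₁ r₂ →
        InfReachGE M T 1 →
        (0 : H) ∈ M →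
        ∃ (Γ : Set H) (Ψ : H → H) (DΨ : H → H →L[ℝ] H),
          IsPatchRepr (T 0) chat 0 Ψ DΨ Γ ∧ Γ ⊆ M := by

  refine ⟨1 / 32, by norm_num, ?_⟩
  intro H _ _ _ _ M T r₁ r₂ hM hreach h0
  have hrank : ∀ z ∈ M, Module.finrank ℝ (T z) = D := fun z hz => (hM.2.2.2 z hz).1
  have hfd : ∀ z ∈ M, FiniteDimensional ℝ (T z) := fun z hz =>
    Module.finite_of_finrank_pos (by rw [hrank z hz]; exact hD)
  haveI := hfd 0 h0
  obtain ⟨ε, hε, hε16, hch⟩ := exists_charts M T hreach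
  have hind : ∀ n : ℕ, ∃ R Ψ, 0 ≤ R ∧ min (n * (ε / 32)) (1 / 32) ≤ R ∧
      GoodGraph M (T 0) R Ψ := by
    intro n
    induction n with
    | zero =>
      refine ⟨0, fun _ => 0, le_rfl, by simp, fun _ _ _ => zero_mem _, rfl,
        fun _ _ _ _ _ _ => by simp, ?_⟩
      intro x hx hx0
      have : x = 0 := by simpa using hx0
      simpa [this] using h0
    | succ n ih =>
      obtain ⟨R, Ψ, hR, hmin, hg⟩ := ih
      by_cases hc : 1 / 32 ≤ R
      · exact ⟨R, Ψ, hR, (min_le_right _ _).trans hc, hg⟩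
      · push Not at hc
        obtain ⟨Ψ', hg'⟩ := hg.extend hfd hrank h0 hε hε16 hch hR hc.le
        refine ⟨R + ε / 32, Ψ', by positivity, (min_le_left _ _).trans ?_, hg'⟩
        rcases min_le_iff.1 hmin with h1 | h1
        · push_cast; linarith
        · linarith
  obtain ⟨n, hn⟩ := exists_nat_ge (1 / ε)
  obtain ⟨R, Ψ, hR, hmin, hg⟩ := hind n
  have hR32 : 1 / 32 ≤ R := by
    refine le_trans (le_min ?_ le_rfl) hmin
    rw [div_le_iff₀ hε] at hn
    linarith
  have hder : ∀ y : H, ∃ B : H →L[ℝ] H, y ∈ patchDom (T 0) (1 / 32) →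
      HasFDerivWithinAt Ψ B (patchDom (T 0) (1 / 32)) y := by
    intro y
    by_cases hy : y ∈ patchDom (T 0) (1 / 32)
    · obtain ⟨B, hB⟩ := hg.deriv hfd hrank h0 hε hch hR32 hy
      exact ⟨B, fun _ => hB⟩
    · exact ⟨0, fun h => absurd h hy⟩
  choose DΨ hDΨ using hder
  refine ⟨_, Ψ, DΨ, ⟨fun x hx => hg.1 x hx.1 (hx.2.le.trans hR32), hg.2.1, hDΨ, rfl⟩, ?_⟩
  rintro _ ⟨x, hx, rfl⟩
  simpa using hg.2.2.2 x hx.1 (hx.2.le.trans hR32)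
end
end
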